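/- Let Δ > 0 be a real target delay. Suppose μ' is an allocation reachable by the greedy process with Σ_k D_k(μ'_k) > Δ, and μ is obtained from μ' by one greedy step with Σ_k D_k(μ_k) ≤ Δ. Then μ minimizes the total number of allocated CPU units over all delay-feasible allocations: every allocation ν with Σ_k D_k(ν_k) ≤ Δ satisfies Σ_k ν_k ≥ Σ_k μ_k. -/

import Mathlib

open Finset

/-- Computational delay of a VM with load parameter `a` and work parameter `c`
under a CPU allocation of `μ` units: `D(μ) = c / (μ - a)`. -/
noncomputable def Dd (a c : ℝ) (μ : ℕ) : ℝ := c / ((μ : ℝ) - a)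

/-- Delay-reduction function `δ(μ) = D(μ) - D(μ+1)`. -/
noncomputable def deltad (a c : ℝ) (μ : ℕ) : ℝ := Dd a c μ - Dd a c (μ + 1)

/-- An allocation is a vector `μ : Fin h → ℕ` with `μ k > a k` for every `k`. -/
def IsAlloc {h : ℕ} (a : Fin h → ℝ) (μ : Fin h → ℕ) : Prop := ∀ k, a k < (μ k : ℝ)

/-- The (total computational) delay of an allocation: `Σ_k D_k(μ_k)`. -/
noncomputable def delay {h : ℕ} (a c : Fin h → ℝ) (μ : Fin h → ℕ) : ℝ :=
  ∑ k, Dd (a k) (c k) (μ k)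

/-- `μ*` is `B`-minimal if its total equals `B` and its delay is less than or equal to
the delay of every allocation whose total equals `B`. -/
def BMinimal {h : ℕ} (a c : Fin h → ℝ) (B : ℕ) (μstar : Fin h → ℕ) : Prop :=
  IsAlloc a μstar ∧ (∑ k, μstar k) = B ∧
    ∀ ν : Fin h → ℕ, IsAlloc a ν → (∑ k, ν k) = B → delay a c μstar ≤ delay a c ν

/-- The initial allocation of the greedy process: `μ⁰_k = ⌊a_k⌋ + 1`. -/
noncomputable def initAlloc {h : ℕ} (a : Fin h → ℝ) : Fin h → ℕ := fun k => ⌊a k⌋₊ + 1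

/-- A greedy step from `μ` to `μ'` chooses an index `k*` maximizing the delay reduction
`δ_k(μ_k)` and increments the allocation of `k*` by one CPU unit. -/
def GreedyStep {h : ℕ} (a c : Fin h → ℝ) (μ μ' : Fin h → ℕ) : Prop :=
  ∃ kstar : Fin h,
    (∀ k, deltad (a k) (c k) (μ k) ≤ deltad (a kstar) (c kstar) (μ kstar)) ∧
    μ' = Function.update μ kstar (μ kstar + 1)

/-- An allocation is reachable if it is obtained from the initial allocation `μ⁰`
by a finite sequence of greedy steps. -/
def Reachable {h : ℕ} (a c : Fin h → ℝ) (μ : Fin h → ℕ) : Prop :=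
  Relation.ReflTransGen (GreedyStep a c) (initAlloc a) μ

theorem deltad_eq_div {a c : ℝ} {m : ℕ} (h : a < m) :
    deltad a c m = c / (((m : ℝ) - a) * ((m : ℝ) + 1 - a)) := by
  have h₁ : (m : ℝ) - a ≠ 0 := by linarith
  have h₂ : (m : ℝ) + 1 - a ≠ 0 := by linarith
  simp only [deltad, Dd, Nat.cast_add, Nat.cast_one]
  field_simp
  ring

theorem deltad_nonneg {a c : ℝ} (hc : 0 < c) {m : ℕ} (h : a < m) : 0 ≤ deltad a c m := by
  rw [deltad_eq_div h]
  have h₁ : 0 < (m : ℝ) - a := by linarith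
  have h₂ : 0 < (m : ℝ) + 1 - a := by linarith
  positivity

/-- Each additional CPU unit reduces the delay by no more than the previous one. -/
theorem deltad_le_deltad {a c : ℝ} (hc : 0 < c) {m n : ℕ} (h : a < m) (hmn : m ≤ n) :
    deltad a c n ≤ deltad a c m := by
  have hmn' : (m : ℝ) ≤ n := by exact_mod_cast hmn
  rw [deltad_eq_div h, deltad_eq_div (h.trans_le hmn')]
  have h₁ : 0 < (m : ℝ) - a := by linarith
  have h₂ : 0 < (m : ℝ) + 1 - a := by linarith
  have h₃ : 0 ≤ (n : ℝ) - a := by linarith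
  gcongr

theorem sub_le_mul_of_forall_sub_succ_le {f : ℕ → ℝ} {t : ℝ} {m n : ℕ} (hmn : m ≤ n)
    (h : ∀ i, m ≤ i → i < n → f i - f (i + 1) ≤ t) : f m - f n ≤ t * ((n : ℝ) - m) := by
  induction n, hmn using Nat.le_induction with
  | base => simp
  | succ n hmn ih =>
    have h₁ := ih fun i hi hin => h i hi (by omega)
    have h₂ := h n hmn (by omega)
    push_cast
    linarith

theorem mul_le_sub_of_forall_le_sub_succ {f : ℕ → ℝ} {t : ℝ} {m n : ℕ} (hmn : m ≤ n)
    (h : ∀ i, m ≤ i → i < n → t ≤ f i - f (i + 1)) : t * ((n : ℝ) - m) ≤ f m - f n := by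
  have := sub_le_mul_of_forall_sub_succ_le (f := fun i => -f i) (t := -t) hmn
    fun i hi hin => by linarith [h i hi hin]
  linarith

theorem initAlloc_isAlloc {h : ℕ} (a : Fin h → ℝ) : IsAlloc a (initAlloc a) := fun k => by
  simpa [initAlloc] using Nat.lt_floor_add_one (a k)

theorem initAlloc_le {h : ℕ} {a : Fin h → ℝ} (ha : ∀ k, 0 ≤ a k) {ν : Fin h → ℕ}
    (hν : IsAlloc a ν) : initAlloc a ≤ ν := fun k =>
  Nat.succ_le_of_lt ((Nat.floor_lt (ha k)).2 (hν k))

theorem IsAlloc.mono {h : ℕ} {a : Fin h → ℝ} {μ ν : Fin h → ℕ} (hμ : IsAlloc a μ)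
    (hμν : μ ≤ ν) : IsAlloc a ν := fun k =>
  (hμ k).trans_le (by exact_mod_cast hμν k)

theorem Reachable.isAlloc {h : ℕ} {a c : Fin h → ℝ} {μ : Fin h → ℕ}
    (hμ : Reachable a c μ) : IsAlloc a μ := by
  induction hμ with
  | refl => exact initAlloc_isAlloc a
  | tail _ hstep ih =>
    obtain ⟨k, -, rfl⟩ := hstep
    exact ih.mono (le_update_self_iff.2 (Nat.le_succ _))

/-- Every CPU unit allocated by the greedy process reduced the delay at least as much as
any unit that could be allocated next. -/
theorem Reachable.deltad_le {h : ℕ} {a c : Fin h → ℝ} (hc : ∀ k, 0 < c k) {μ : Fin h → ℕ}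
    (hμ : Reachable a c μ) (j k : Fin h) {m : ℕ} (hm : initAlloc a k ≤ m) (hmμ : m < μ k) :
    deltad (a j) (c j) (μ j) ≤ deltad (a k) (c k) m := by
  induction hμ with
  | refl => omega
  | @tail ν _ hν hstep ih =>
    obtain ⟨i, hi, rfl⟩ := hstep
    have hle : ν j ≤ Function.update ν i (ν i + 1) j :=
      le_update_self_iff.2 (Nat.le_succ _) j
    refine (deltad_le_deltad (hc j) (Reachable.isAlloc hν j) hle).trans ?_
    by_cases hmν : m < ν k
    · exact ih hmν
    · obtain rfl : k = i := by
        by_contra hki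
        simp [hki, hmν] at hmμ
      obtain rfl : m = ν k := by
        simp at hmμ
        omega
      exact hi j

/-- If `t` bounds the marginal delay reductions at `μ` from above and those of the units
already allocated in `μ` from below, then `μ` has least delay among the allocations
using at most as many units. -/
theorem delay_le_of_sum_le {h : ℕ} {a c : Fin h → ℝ} (ha : ∀ k, 0 ≤ a k)
    (hc : ∀ k, 0 < c k) {μ ν : Fin h → ℕ} (hμ : IsAlloc a μ) (hν : IsAlloc a ν) {t : ℝ}
    (ht : 0 ≤ t) (hub : ∀ k, deltad (a k) (c k) (μ k) ≤ t)
    (hlb : ∀ k m, initAlloc a k ≤ m → m < μ k → t ≤ deltad (a k) (c k) m)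
    (hsum : ∑ k, ν k ≤ ∑ k, μ k) : delay a c μ ≤ delay a c ν := by
  have hk : ∀ k, Dd (a k) (c k) (μ k) - Dd (a k) (c k) (ν k) ≤ t * ((ν k : ℝ) - μ k) := by
    intro k
    rcases le_total (μ k) (ν k) with hle | hle
    · exact sub_le_mul_of_forall_sub_succ_le hle fun i hi _ =>
        (deltad_le_deltad (hc k) (hμ k) hi).trans (hub k)
    · have := mul_le_sub_of_forall_le_sub_succ (f := Dd (a k) (c k)) hle fun i hi hin =>
        hlb k i ((initAlloc_le ha hν k).trans hi) hin
      linarith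
  have hsum_le := Finset.sum_le_sum fun k (_ : k ∈ Finset.univ) => hk k
  rw [← Finset.mul_sum, Finset.sum_sub_distrib, Finset.sum_sub_distrib] at hsum_le
  have hcast : (∑ k, (ν k : ℝ)) ≤ ∑ k, (μ k : ℝ) := by exact_mod_cast hsum
  have := mul_nonpos_of_nonneg_of_nonpos ht (sub_nonpos.2 hcast)
  unfold delay
  linarith

/-- Let `Δ > 0` be a real target delay. Suppose `μ'` is an allocation
reachable by the greedy process with delay `> Δ`, and `μ` is obtained from `μ'` by one
greedy step with delay `≤ Δ`. Then `μ` minimizes the total number of allocated CPU units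
over all delay-feasible allocations. -/
theorem greedy_finds_min_budget {h : ℕ} (hh : 1 ≤ h) (a c : Fin h → ℝ)
    (ha : ∀ k, 0 ≤ a k) (hc : ∀ k, 0 < c k)
    (Δ : ℝ) (hΔ : 0 < Δ)
    (μ' μ : Fin h → ℕ) (hreach : Reachable a c μ')
    (hd' : Δ < delay a c μ')
    (hstep : GreedyStep a c μ' μ)
    (hd : delay a c μ ≤ Δ) :
    ∀ ν : Fin h → ℕ, IsAlloc a ν → delay a c ν ≤ Δ →
      (∑ k, μ k) ≤ (∑ k, ν k) := by
  intro ν hν hνΔ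
  obtain ⟨i, hi, rfl⟩ := hstep
  by_contra! hlt
  have hsum : ∑ k, Function.update μ' i (μ' i + 1) k = ∑ k, μ' k + 1 := by
    rw [Finset.sum_update_of_mem (Finset.mem_univ i),
      ← Finset.add_sum_erase _ _ (Finset.mem_univ i), Finset.sdiff_singleton_eq_erase]
    omega
  have hle := delay_le_of_sum_le ha hc hreach.isAlloc hν
    (deltad_nonneg (hc i) (hreach.isAlloc i)) hi
    (fun k m hm hmμ => hreach.deltad_le hc i k hm hmμ) (by omega)
  linarith
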